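/- For all real ν ≥ 0 and all x > 0, I_{ν−1}(x)/I_ν(x) < (2g/3x)·cos((1/3)·arccos(h/g³)) + (ν − 1/3)/x, where g = √(3(ν² + x²) + 1) and h = 9ν² − (9/2)x² − 1. -/

import Mathlib

open Real

/-- Modified Bessel function of the first kind `I_ν(x)` (for `x > 0`),
defined by its standard power series. -/
noncomputable def besselI (ν x : ℝ) : ℝ :=
  ∑' k : ℕ, (x / 2) ^ (2 * k) / ((Nat.factorial k : ℝ) * Real.Gamma (k + ν + 1)) * (x / 2) ^ ν

/-- Modified Bessel function of the second kind `K_ν(x)` (for `x > 0`),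
defined by its standard integral representation. -/
noncomputable def besselK (ν x : ℝ) : ℝ :=
  ∫ t in Set.Ioi (0 : ℝ), Real.exp (-x * Real.cosh t) * Real.cosh (ν * t)


lemma aux_summable (c : ℕ → ℝ) (C : ℝ) (hc : ∀ k, |c k| ≤ C / (Nat.factorial k : ℝ)) (z : ℝ) :
    Summable (fun k => c k * z ^ k) := by
  have h := (Real.summable_pow_div_factorial |z|).mul_left C
  refine Summable.of_norm_bounded h (fun k => ?_)
  rw [Real.norm_eq_abs, abs_mul, abs_pow]
  calc |c k| * |z| ^ k ≤ C / (Nat.factorial k : ℝ) * |z| ^ k :=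
        mul_le_mul_of_nonneg_right (hc k) (by positivity)
    _ = _ := by ring

lemma aux_shift (c : ℕ → ℝ) (C : ℝ) (hc : ∀ k, |c k| ≤ C / (Nat.factorial k : ℝ)) (k : ℕ) :
    |((k : ℝ) + 1) * c (k + 1)| ≤ C / (Nat.factorial k : ℝ) := by
  rw [abs_mul, abs_of_nonneg (by positivity : (0:ℝ) ≤ (k:ℝ) + 1)]
  have h := mul_le_mul_of_nonneg_left (hc (k + 1)) (by positivity : (0:ℝ) ≤ (k:ℝ) + 1)
  refine h.trans (le_of_eq ?_)
  rw [Nat.factorial_succ]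
  push_cast
  have : (Nat.factorial k : ℝ) ≠ 0 := by positivity
  field_simp

lemma aux_deriv (c : ℕ → ℝ) (C : ℝ) (hc : ∀ k, |c k| ≤ C / (Nat.factorial k : ℝ)) (z : ℝ) :
    HasDerivAt (fun z => ∑' k, c k * z ^ k)
      (∑' k : ℕ, (((k : ℝ) + 1) * c (k + 1)) * z ^ k) z := by
  have hs := aux_summable _ C (aux_shift c C hc)
  have key : HasDerivAt (fun z => ∑' k, c k * z ^ k)
      (∑' k : ℕ, c k * ((k : ℝ) * z ^ (k - 1))) z := by
    have hC : 0 ≤ C := by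
      have := (abs_nonneg _).trans (hc 0)
      simpa using this
    set R : ℝ := |z| + 1 with hR
    refine hasDerivAt_tsum_of_isPreconnected (𝕜 := ℝ)
      (u := fun k => C / (Nat.factorial k : ℝ) * ((k : ℝ) * R ^ (k - 1)))
      (t := Metric.ball 0 R) (y₀ := 0) ?_ Metric.isOpen_ball
      (convex_ball _ _).isPreconnected
      (fun k y _ => ((hasDerivAt_pow k y).const_mul (c k))) ?_ ?_ (aux_summable c C hc 0) ?_
    · rw [← summable_nat_add_iff 1]
      refine ((Real.summable_pow_div_factorial R).mul_left C).congr (fun k => ?_)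
      rw [Nat.factorial_succ]
      push_cast
      have : (Nat.factorial k : ℝ) ≠ 0 := by positivity
      field_simp
    · intro k y hy
      rw [Metric.mem_ball, dist_zero_right, Real.norm_eq_abs] at hy
      rw [Real.norm_eq_abs, abs_mul, abs_mul, abs_pow, Nat.abs_cast]
      gcongr
      exact hc k
    · simp; positivity
    · simp [hR]
  convert key using 1
  have hs2 : Summable (fun k : ℕ => c k * ((k : ℝ) * z ^ (k - 1))) := by
    rw [← summable_nat_add_iff 1]
    refine (hs z).congr (fun k => ?_)
    push_cast
    ring
  rw [hs2.tsum_eq_zero_add]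
  simp only [Nat.cast_zero, zero_mul, mul_zero, zero_add]
  refine tsum_congr (fun k => ?_)
  push_cast
  ring

/-- coefficients -/
noncomputable def bc (ν : ℝ) (k : ℕ) : ℝ := 1 / ((Nat.factorial k : ℝ) * Real.Gamma (k + ν + 1))

lemma bc_pos (ν : ℝ) (hν : 0 ≤ ν) (k : ℕ) : 0 < bc ν k := by
  unfold bc
  have : 0 < Real.Gamma (k + ν + 1) := Real.Gamma_pos_of_pos (by positivity)
  positivity

lemma bc_rec (ν : ℝ) (hν : 0 ≤ ν) (k : ℕ) :
    ((k : ℝ) + 1) * (k + 1 + ν) * bc ν (k + 1) = bc ν k := by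
  unfold bc
  have h0 : 0 < Real.Gamma (k + ν + 1) := Real.Gamma_pos_of_pos (by positivity)
  have h1 : (k : ℝ) + ν + 1 ≠ 0 := by positivity
  have e : (((k + 1 : ℕ) : ℝ) + ν + 1) = ((k : ℝ) + ν + 1) + 1 := by push_cast; ring
  rw [e, Real.Gamma_add_one h1, Nat.factorial_succ]
  push_cast
  have : (Nat.factorial k : ℝ) ≠ 0 := by positivity
  field_simp
  ring

lemma bc_bound (ν : ℝ) (hν : 0 ≤ ν) (k : ℕ) : |bc ν k| ≤ bc ν 0 / (Nat.factorial k : ℝ) := by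
  rw [abs_of_pos (bc_pos ν hν k)]
  induction k with
  | zero => simp
  | succ k ih =>
    have h := bc_rec ν hν k
    have hp := bc_pos ν hν (k + 1)
    have hk : (0:ℝ) ≤ k := by positivity
    rw [Nat.factorial_succ]
    push_cast
    have hf : (0:ℝ) < (Nat.factorial k : ℝ) := by positivity
    rw [le_div_iff₀ hf] at ih
    rw [le_div_iff₀ (by positivity)]
    refine le_trans ?_ ih
    rw [← h]
    have : 0 ≤ ((k:ℝ) + 1) * bc ν (k + 1) * (Nat.factorial k : ℝ) * (k + ν) := by positivity
    nlinarith

noncomputable def bf (ν z : ℝ) : ℝ := ∑' k, bc ν k * z ^ k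
noncomputable def bf1 (ν z : ℝ) : ℝ := ∑' k : ℕ, (((k : ℝ) + 1) * bc ν (k + 1)) * z ^ k
noncomputable def bf2 (ν z : ℝ) : ℝ :=
  ∑' k : ℕ, (((k : ℝ) + 1) * ((((k + 1 : ℕ) : ℝ) + 1) * bc ν (k + 1 + 1))) * z ^ k

lemma bf_deriv (ν : ℝ) (hν : 0 ≤ ν) (z : ℝ) : HasDerivAt (bf ν) (bf1 ν z) z :=
  aux_deriv _ _ (bc_bound ν hν) z

lemma bf1_deriv (ν : ℝ) (hν : 0 ≤ ν) (z : ℝ) : HasDerivAt (bf1 ν) (bf2 ν z) z :=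
  aux_deriv _ _ (aux_shift _ _ (bc_bound ν hν)) z

lemma bf_pos (ν : ℝ) (hν : 0 ≤ ν) (z : ℝ) (hz : 0 ≤ z) : 0 < bf ν z := by
  refine (aux_summable _ _ (bc_bound ν hν) z).tsum_pos (fun k => ?_) 0 ?_
  · have := bc_pos ν hν k; positivity
  · have := bc_pos ν hν 0; simpa using this

lemma bf1_pos (ν : ℝ) (hν : 0 ≤ ν) (z : ℝ) (hz : 0 ≤ z) : 0 < bf1 ν z := by
  refine (aux_summable _ _ (aux_shift _ _ (bc_bound ν hν)) z).tsum_pos (fun k => ?_) 0 ?_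
  · have := bc_pos ν hν (k+1); positivity
  · have := bc_pos ν hν 1; simpa using this

lemma aux_mul (c : ℕ → ℝ) (C : ℝ) (hc : ∀ k, |c k| ≤ C / (Nat.factorial k : ℝ)) (z : ℝ) :
    HasSum (fun k : ℕ => (k : ℝ) * c k * z ^ k)
      (z * ∑' k : ℕ, (((k : ℝ) + 1) * c (k + 1)) * z ^ k) := by
  rw [← hasSum_nat_add_iff' 1]
  have := ((aux_summable _ _ (aux_shift _ _ hc) z).hasSum).mul_left z
  simp only [Finset.range_one, Finset.sum_singleton, Nat.cast_zero, zero_mul, sub_zero]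
  refine Eq.mp (congrArg (fun F => HasSum F _) (funext fun k => ?_)) this
  push_cast
  ring

lemma bf_ode (ν : ℝ) (hν : 0 ≤ ν) (z : ℝ) :
    z * bf2 ν z = bf ν z - (ν + 1) * bf1 ν z := by
  have h2 : HasSum _ (z * bf2 ν z) := aux_mul _ _ (aux_shift _ _ (bc_bound ν hν)) z
  have h1 : HasSum _ (bf1 ν z) := (aux_summable _ _ (aux_shift _ _ (bc_bound ν hν)) z).hasSum
  have h0 : HasSum _ (bf ν z) := (aux_summable _ _ (bc_bound ν hν) z).hasSum
  refine h2.unique ?_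
  refine Eq.mp (congrArg (fun F => HasSum F _) (funext fun k => ?_)) (h0.sub (h1.mul_left (ν + 1)))
  rw [← bc_rec ν hν k]
  ring

lemma besselI_eq (ν x : ℝ) : besselI ν x = bf ν ((x / 2) ^ 2) * (x / 2) ^ ν := by
  unfold besselI bf
  rw [← tsum_mul_right]
  refine tsum_congr (fun k => ?_)
  rw [bc, pow_mul]
  ring

lemma besselI_sub_eq (ν x : ℝ) (hν : 0 ≤ ν) :
    besselI (ν - 1) x =
      (ν * bf ν ((x / 2) ^ 2) + (x / 2) ^ 2 * bf1 ν ((x / 2) ^ 2)) * (x / 2) ^ (ν - 1) := by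
  unfold besselI
  rw [tsum_mul_right]
  congr 1
  have h0 : HasSum _ (bf ν ((x / 2) ^ 2)) := (aux_summable _ _ (bc_bound ν hν) _).hasSum
  have h1 : HasSum _ ((x / 2) ^ 2 * bf1 ν ((x / 2) ^ 2)) := aux_mul _ _ (bc_bound ν hν) _
  rw [← ((h0.mul_left ν).add h1).tsum_eq]
  refine tsum_congr (fun k => ?_)
  have e : (k : ℝ) + (ν - 1) + 1 = k + ν := by ring
  rw [e, pow_mul, bc]
  have hk : (0:ℝ) ≤ k := by positivity
  have : (Nat.factorial k : ℝ) ≠ 0 := by positivity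
  rcases (add_nonneg hk hν).eq_or_lt with h | h
  · have hν0 : ν = 0 := by linarith
    have hk0 : (k:ℝ) = 0 := by linarith
    rw [← h]
    simp [hν0, hk0]
  · have hG := Real.Gamma_pos_of_pos h
    rw [Real.Gamma_add_one h.ne']
    field_simp
    ring

noncomputable def bp (ν z : ℝ) : ℝ := ν + 2 * z * (bf1 ν z / bf ν z)
noncomputable def bq (ν z : ℝ) : ℝ := 4 * z + ν ^ 2 - bp ν z ^ 2
noncomputable def bw (ν z : ℝ) : ℝ := z ^ ν * bf ν z ^ 2

lemma bp_deriv (ν : ℝ) (hν : 0 ≤ ν) (z : ℝ) (hz : 0 < z) :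
    HasDerivAt (bp ν) (bq ν z / (2 * z)) z := by
  have hf := (bf_pos ν hν z hz.le).ne'
  have h := (((hasDerivAt_id z).const_mul 2).mul
    ((bf1_deriv ν hν z).div (bf_deriv ν hν z) hf)).const_add ν
  refine HasDerivAt.congr_deriv h ?_
  have e : bf2 ν z = (bf ν z - (ν + 1) * bf1 ν z) / z := by
    rw [← bf_ode ν hν]; field_simp
  unfold bq bp
  simp only [id, Pi.div_apply]
  rw [e]
  field_simp
  ring

lemma bq_deriv (ν : ℝ) (hν : 0 ≤ ν) (z : ℝ) (hz : 0 < z) :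
    HasDerivAt (bq ν) (4 - bp ν z * bq ν z / z) z := by
  have h := ((((hasDerivAt_id z).const_mul 4).add_const (ν ^ 2)).sub
    ((bp_deriv ν hν z hz).pow 2))
  refine HasDerivAt.congr_deriv h ?_
  field_simp
  norm_num
  ring

lemma bw_deriv (ν : ℝ) (hν : 0 ≤ ν) (z : ℝ) (hz : 0 < z) :
    HasDerivAt (bw ν) (bw ν z * bp ν z / z) z := by
  have hf := (bf_pos ν hν z hz.le).ne'
  have h := (Real.hasDerivAt_rpow_const (p := ν) (Or.inl hz.ne')).mul ((bf_deriv ν hν z).pow 2)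
  refine HasDerivAt.congr_deriv h ?_
  rw [Real.rpow_sub_one hz.ne']
  unfold bw bp
  simp only [Pi.pow_apply]
  field_simp
  norm_num
  ring

lemma bw_pos (ν : ℝ) (hν : 0 ≤ ν) (z : ℝ) (hz : 0 < z) : 0 < bw ν z := by
  have hf := bf_pos ν hν z hz.le
  have := Real.rpow_pos_of_pos hz ν
  unfold bw
  positivity

lemma bp_cont (ν : ℝ) (hν : 0 ≤ ν) : ContinuousOn (bp ν) (Set.Ici 0) := by
  have h0 : Continuous (bf ν) := continuous_iff_continuousAt.2 fun z => (bf_deriv ν hν z).continuousAt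
  have h1 : Continuous (bf1 ν) := continuous_iff_continuousAt.2 fun z => (bf1_deriv ν hν z).continuousAt
  unfold bp
  exact continuousOn_const.add ((continuous_const.mul continuous_id).continuousOn.mul
    (h1.continuousOn.div h0.continuousOn fun z hz => (bf_pos ν hν z hz).ne'))

lemma bq_cont (ν : ℝ) (hν : 0 ≤ ν) : ContinuousOn (bq ν) (Set.Ici 0) := by
  have := bp_cont ν hν
  unfold bq
  fun_prop

lemma bw_cont (ν : ℝ) (hν : 0 ≤ ν) : ContinuousOn (bw ν) (Set.Ici 0) := by
  have h0 : Continuous (bf ν) := continuous_iff_continuousAt.2 fun z => (bf_deriv ν hν z).continuousAt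
  unfold bw
  exact ((Real.continuous_rpow_const hν).mul (h0.pow 2)).continuousOn

lemma aux_pos (G G' : ℝ → ℝ) (hc : ContinuousOn G (Set.Ici 0)) (h0 : G 0 = 0)
    (hd : ∀ z, 0 < z → HasDerivAt G (G' z) z) (hp : ∀ z, 0 < z → 0 < G' z) (z : ℝ) (hz : 0 < z) :
    0 < G z := by
  have := strictMonoOn_of_deriv_pos (convex_Ici 0) hc (fun y hy => by
    rw [interior_Ici] at hy
    rw [(hd y hy).deriv]
    exact hp y hy)
  rw [← h0]
  exact this Set.self_mem_Ici (Set.mem_Ici.2 hz.le) hz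

lemma bq_pos (ν : ℝ) (hν : 0 ≤ ν) (z : ℝ) (hz : 0 < z) : 0 < bq ν z := by
  have h := aux_pos (fun z => bw ν z * bq ν z) (fun z => 4 * bw ν z)
    ((bw_cont ν hν).mul (bq_cont ν hν)) (by simp [bq, bp]) (fun z hz => by
      refine ((bw_deriv ν hν z hz).mul (bq_deriv ν hν z hz)).congr_deriv ?_
      field_simp
      ring) (fun z hz => by have := bw_pos ν hν z hz; positivity) z hz
  exact pos_of_mul_pos_right h (bw_pos ν hν z hz).le

lemma bF_pos (ν : ℝ) (hν : 0 ≤ ν) (z : ℝ) (hz : 0 < z) :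
    0 < bq ν z * (bp ν z + 1) - 4 * z := by
  have h := aux_pos (fun z => bw ν z * (bq ν z * (bp ν z + 1) - 4 * z))
    (fun z => bw ν z * bq ν z ^ 2 / (2 * z))
    ((bw_cont ν hν).mul (((bq_cont ν hν).mul ((bp_cont ν hν).add continuousOn_const)).sub
      (continuous_const.mul continuous_id).continuousOn)) (by simp [bq, bp]) (fun z hz => by
      refine ((bw_deriv ν hν z hz).mul (((bq_deriv ν hν z hz).mul
        ((bp_deriv ν hν z hz).add_const 1)).sub ((hasDerivAt_id z).const_mul 4))).congr_deriv ?_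
      simp only [id, Pi.mul_apply, Pi.sub_apply]
      field_simp
      ring) (fun z hz => by
        have := bw_pos ν hν z hz
        have := bq_pos ν hν z hz
        positivity) z hz
  exact pos_of_mul_pos_right h (bw_pos ν hν z hz).le

lemma trig_root (a b s : ℝ) (ha : 0 ≤ a) (hb : 0 ≤ b)
    (hs : s ^ 3 - (3 * (a + b) + 1) * s / 3 < 2 / 27 * (9 * a - 9 / 2 * b - 1)) :
    s < 2 / 3 * Real.sqrt (3 * (a + b) + 1) *
      Real.cos (1 / 3 * Real.arccos ((9 * a - 9 / 2 * b - 1) /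
          Real.sqrt (3 * (a + b) + 1) ^ 3)) := by
  set g := Real.sqrt (3 * (a + b) + 1) with hg
  set h := 9 * a - 9 / 2 * b - 1 with hh
  have hgp : 0 < g := Real.sqrt_pos.2 (by positivity)
  have hg2 : g ^ 2 = 3 * (a + b) + 1 := Real.sq_sqrt (by positivity)
  have hle : h ^ 2 ≤ (g ^ 3) ^ 2 := by
    have : (g ^ 3) ^ 2 = (g ^ 2) ^ 3 := by ring
    rw [this, hg2, hh]
    have : 0 ≤ 27 * a * (a - 1) ^ 2 + 81 * a ^ 2 * b + 81 * a * b ^ 2 + 27 * b ^ 3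
      + 135 * a * b + 27 / 4 * b ^ 2 := by positivity
    nlinarith
  have hab := abs_le_of_sq_le_sq' hle (by positivity)
  have hg3 : 0 < g ^ 3 := by positivity
  set t := Real.arccos (h / g ^ 3) with ht
  have hcos : Real.cos t = h / g ^ 3 :=
    Real.cos_arccos (by rw [le_div_iff₀ hg3]; linarith) (by rw [div_le_iff₀ hg3]; linarith)
  have h3 : Real.cos t = 4 * Real.cos (1 / 3 * t) ^ 3 - 3 * Real.cos (1 / 3 * t) := by
    rw [← Real.cos_three_mul]; congr 1; ring
  have hc : 1 / 2 ≤ Real.cos (1 / 3 * t) := by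
    rw [← Real.cos_pi_div_three]
    have h0 := Real.arccos_nonneg (h / g ^ 3)
    have h1 := Real.arccos_le_pi (h / g ^ 3)
    rw [← ht] at h0 h1
    exact Real.cos_le_cos_of_nonneg_of_le_pi (by linarith) (by linarith [Real.pi_pos]) (by linarith)
  set c := Real.cos (1 / 3 * t) with hcdef
  by_contra hcon
  push Not at hcon
  rw [← hg2] at hs
  set S := 2 / 3 * g * c with hS
  have hroot : S ^ 3 - g ^ 2 * S / 3 = 2 / 27 * h := by
    have : h = g ^ 3 * (4 * c ^ 3 - 3 * c) := by
      rw [← h3, hcos]; field_simp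
    rw [this, hS]; ring
  have hSg : g / 3 ≤ S := by rw [hS]; nlinarith
  have hfac : (s ^ 3 - g ^ 2 * s / 3) - (S ^ 3 - g ^ 2 * S / 3)
      = (s - S) * (s ^ 2 + s * S + S ^ 2 - g ^ 2 / 3) := by ring
  have h1 : 0 ≤ s ^ 2 + s * S + S ^ 2 - g ^ 2 / 3 := by
    have : g / 3 ≤ s := hSg.trans hcon
    nlinarith [mul_le_mul this hSg (by positivity) (by linarith),
      mul_le_mul this this (by positivity) (by linarith),
      mul_le_mul hSg hSg (by positivity) (by linarith)]
  have := mul_nonneg (sub_nonneg.2 hcon) h1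
  linarith

theorem besselI_ratio_trig_upper_bound (ν x : ℝ) (hν : 0 ≤ ν) (hx : 0 < x) :
    besselI (ν - 1) x / besselI ν x <
      2 * Real.sqrt (3 * (ν ^ 2 + x ^ 2) + 1) / (3 * x) *
        Real.cos (1 / 3 * Real.arccos ((9 * ν ^ 2 - 9 / 2 * x ^ 2 - 1) /
          Real.sqrt (3 * (ν ^ 2 + x ^ 2) + 1) ^ 3)) + (ν - 1 / 3) / x := by
  have hz : 0 < (x / 2) ^ 2 := by positivity
  have hf := bf_pos ν hν _ hz.le
  have hF := bF_pos ν hν _ hz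
  have hratio : besselI (ν - 1) x / besselI ν x = (bp ν ((x / 2) ^ 2) + ν) / x := by
    rw [besselI_sub_eq ν x hν, besselI_eq, Real.rpow_sub_one (by positivity), bp]
    have := Real.rpow_pos_of_pos (half_pos hx) ν
    generalize (x / 2) ^ ν = y at *
    generalize bf ν ((x / 2) ^ 2) = f0 at *
    generalize bf1 ν ((x / 2) ^ 2) = f1 at *
    field_simp
    ring
  rw [hratio]
  have key := trig_root (ν ^ 2) (x ^ 2) (bp ν ((x / 2) ^ 2) + 1 / 3) (by positivity)
    (by positivity) (by
      unfold bq at hF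
      nlinarith)
  calc (bp ν ((x / 2) ^ 2) + ν) / x
      = (bp ν ((x / 2) ^ 2) + 1 / 3) / x + (ν - 1 / 3) / x := by ring
    _ < (2 / 3 * Real.sqrt (3 * (ν ^ 2 + x ^ 2) + 1) *
      Real.cos (1 / 3 * Real.arccos ((9 * ν ^ 2 - 9 / 2 * x ^ 2 - 1) /
          Real.sqrt (3 * (ν ^ 2 + x ^ 2) + 1) ^ 3))) / x + (ν - 1 / 3) / x := by
        gcongr
    _ = _ := by
        congr 1
        field_simp
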